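/- Let ρ̃ be a density matrix on ℂ^{n₁n₂} and let C := {gambles (x,y) ↦ (x⊗y)†G(x⊗y) on unit vectors x ∈ ℂ^{n₁}, y ∈ ℂ^{n₂} : G Hermitian with Tr(Gρ̃) ≥ 0}. Then ρ̃ is entangled if and only if posi(C ∪ 𝓛≥) contains a gamble with strictly negative supremum (i.e. is incoherent); equivalently, ρ̃ is entangled if and only if there exists a Hermitian matrix G with Tr(Gρ̃) ≥ 0 and sup{(x⊗y)†G(x⊗y) : x ∈ ℂ^{n₁}, y ∈ ℂ^{n₂}, x†x = y†y = 1} < 0. -/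

import Mathlib

open Matrix Kronecker
open scoped ComplexOrder

noncomputable section

/-- The Kronecker product of column vectors `x ∈ ℂ^{n₁}`, `y ∈ ℂ^{n₂}`. -/
def vKron {n₁ n₂ : ℕ} (x : Fin n₁ → ℂ) (y : Fin n₂ → ℂ) : Fin n₁ × Fin n₂ → ℂ :=
  fun p => x p.1 * y p.2

/-- A density matrix: positive semidefinite (hence Hermitian) with trace 1. -/
def IsDensity {d : Type*} [Fintype d] [DecidableEq d] (ρ : Matrix d d ℂ) : Prop :=
  ρ.PosSemidef ∧ ρ.trace = 1

/-- Separability of a bipartite density matrix. -/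
def Separable {n₁ n₂ : ℕ} (ρ : Matrix (Fin n₁ × Fin n₂) (Fin n₁ × Fin n₂) ℂ) :
    Prop :=
  ∃ (k : ℕ) (p : Fin k → ℝ) (A : Fin k → Matrix (Fin n₁) (Fin n₁) ℂ)
      (B : Fin k → Matrix (Fin n₂) (Fin n₂) ℂ),
    (∀ i, 0 ≤ p i) ∧ (∑ i, p i = 1) ∧ (∀ i, IsDensity (A i)) ∧
      (∀ i, IsDensity (B i)) ∧ ρ = ∑ i, p i • (A i ⊗ₖ B i)

/-- The possibility space: pairs of unit vectors in `ℂ^{n₁}` and `ℂ^{n₂}`. -/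
abbrev POmega (n₁ n₂ : ℕ) :=
  {x : Fin n₁ → ℂ // star x ⬝ᵥ x = 1} × {y : Fin n₂ → ℂ // star y ⬝ᵥ y = 1}

/-- The gamble `(x,y) ↦ (x⊗y)† G (x⊗y)` (real for Hermitian `G`). -/
def bGamble {n₁ n₂ : ℕ} (G : Matrix (Fin n₁ × Fin n₂) (Fin n₁ × Fin n₂) ℂ) :
    POmega n₁ n₂ → ℝ :=
  fun ω => (star (vKron ω.1.1 ω.2.1) ⬝ᵥ G *ᵥ vKron ω.1.1 ω.2.1).re

/-- The nonnegative (bounded) gambles `𝓛≥`. -/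
def Lnn (n₁ n₂ : ℕ) : Set (POmega n₁ n₂ → ℝ) :=
  {g | (∀ ω, 0 ≤ g ω) ∧ ∃ M : ℝ, ∀ ω, g ω ≤ M}

/-- `posi S`: all finite nonnegative linear combinations of elements of `S`. -/
def posi {n₁ n₂ : ℕ} (S : Set (POmega n₁ n₂ → ℝ)) : Set (POmega n₁ n₂ → ℝ) :=
  {h | ∃ (ℓ : ℕ) (lam : Fin ℓ → ℝ) (gs : Fin ℓ → POmega n₁ n₂ → ℝ),
    (∀ i, 0 ≤ lam i) ∧ (∀ i, gs i ∈ S) ∧ h = fun ω => ∑ i, lam i * gs i ω}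

/-- The set `C` of desirable gambles determined by a density matrix `ρ̃`:
gambles `(x⊗y)† G (x⊗y)` with `G` Hermitian and `Tr(Gρ̃) ≥ 0`. -/
def Cof {n₁ n₂ : ℕ} (ρ : Matrix (Fin n₁ × Fin n₂) (Fin n₁ × Fin n₂) ℂ) :
    Set (POmega n₁ n₂ → ℝ) :=
  {g | ∃ G : Matrix (Fin n₁ × Fin n₂) (Fin n₁ × Fin n₂) ℂ,
    G.IsHermitian ∧ 0 ≤ (G * ρ).trace ∧ g = bGamble G}

/-- In a finite-dimensional space, the convex hull of a compact set is compact. -/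
theorem isCompact_convexHull_of_finiteDimensional {E : Type*} [AddCommGroup E] [Module ℝ E]
    [FiniteDimensional ℝ E] [TopologicalSpace E] [ContinuousAdd E] [ContinuousSMul ℝ E]
    {s : Set E} (hs : IsCompact s) : IsCompact (convexHull ℝ s) := by
  rcases s.eq_empty_or_nonempty with rfl | ⟨a, ha⟩
  · simp
  let N := Module.finrank ℝ E + 1
  have hc : IsCompact ((fun q : (Fin N → ℝ) × (Fin N → E) => ∑ i, q.1 i • q.2 i) ''
      (stdSimplex ℝ (Fin N) ×ˢ Set.univ.pi fun _ => s)) := by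
    refine ((isCompact_stdSimplex ℝ (Fin N)).prod (isCompact_univ_pi fun _ => hs)).image ?_
    fun_prop
  convert hc using 1
  apply Set.Subset.antisymm
  · intro x hx
    obtain ⟨ι, _, z, w, hz, hind, hw, hw1, rfl⟩ := eq_pos_convex_span_of_mem_convexHull hx
    have hcard : Fintype.card ι ≤ Fintype.card (Fin N) := by
      rw [Fintype.card_fin]
      exact hind.card_le_finrank_succ.trans (Nat.succ_le_succ (Submodule.finrank_le _))
    obtain ⟨e⟩ := Function.Embedding.nonempty_of_card_le hcard
    have hext : ∀ j, j ∉ Set.range e → Function.extend e w 0 j = 0 := by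
      intro j hj
      rw [Function.extend_apply' _ _ _ (by simpa using hj)]
      rfl
    refine ⟨(Function.extend e w 0, Function.extend e z fun _ => a), ⟨⟨fun j => ?_, ?_⟩, ?_⟩, ?_⟩
    · by_cases hj : j ∈ Set.range e
      · obtain ⟨i, rfl⟩ := hj
        simpa [e.injective.extend_apply] using (hw i).le
      · exact (hext j hj).ge
    · rw [← hw1]
      symm
      apply Finset.sum_of_injOn e e.injective.injOn
      · simp
      · intro j _ hj
        exact hext j (by simpa using hj)
      · intro i _
        simp [e.injective.extend_apply]
    · intro j _
      by_cases hj : j ∈ Set.range e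
      · obtain ⟨i, rfl⟩ := hj
        simpa [e.injective.extend_apply] using hz ⟨i, rfl⟩
      · simpa [Function.extend_apply' _ _ _ (show ¬∃ i, e i = j by simpa using hj)] using ha
    · symm
      apply Finset.sum_of_injOn e e.injective.injOn
      · simp
      · intro j _ hj
        simp only [hext j (by simpa using hj), zero_smul]
      · intro i _
        simp [e.injective.extend_apply]
  · rintro _ ⟨⟨w, z⟩, ⟨⟨hw0, hw1⟩, hz⟩, rfl⟩
    exact (convex_convexHull ℝ s).sum_mem (fun i _ => hw0 i) hw1
      fun i _ => subset_convexHull ℝ s (hz i trivial)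

/-- The rank-one projection onto the product vector `x ⊗ y`. -/
def productState {n₁ n₂ : ℕ} (ω : POmega n₁ n₂) :
    Matrix (Fin n₁ × Fin n₂) (Fin n₁ × Fin n₂) ℂ :=
  vecMulVec (vKron ω.1.1 ω.2.1) (star (vKron ω.1.1 ω.2.1))

theorem productState_eq_kronecker {n₁ n₂ : ℕ} (ω : POmega n₁ n₂) :
    productState ω = vecMulVec ω.1.1 (star ω.1.1) ⊗ₖ vecMulVec ω.2.1 (star ω.2.1) := by
  ext i j
  simp [productState, vecMulVec_apply, vKron, kroneckerMap_apply]
  ring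

theorem bGamble_eq_re_trace {n₁ n₂ : ℕ} (G : Matrix (Fin n₁ × Fin n₂) (Fin n₁ × Fin n₂) ℂ)
    (ω : POmega n₁ n₂) : bGamble G ω = (G * productState ω).trace.re := by
  rw [bGamble, productState, mul_vecMulVec, trace_vecMulVec, dotProduct_comm]

instance compactSpace_unitSphere (n : ℕ) :
    CompactSpace {x : Fin n → ℂ // star x ⬝ᵥ x = 1} := by
  apply isCompact_iff_compactSpace.mp
  change IsCompact {x : Fin n → ℂ | star x ⬝ᵥ x = 1}
  apply Metric.isCompact_of_isClosed_isBounded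
  · exact isClosed_eq (by unfold dotProduct; simp only [Pi.star_apply]; fun_prop) continuous_const
  · refine (Metric.isBounded_closedBall (x := 0) (r := 1)).subset fun x hx => ?_
    rw [mem_closedBall_zero_iff, pi_norm_le_iff_of_nonneg zero_le_one]
    intro i
    have h : ∑ j, ‖x j‖ ^ 2 = 1 := by
      have h' : star x ⬝ᵥ x = 1 := hx
      simp only [dotProduct, Pi.star_apply, RCLike.star_def, Complex.conj_mul'] at h'
      exact_mod_cast h'
    have := Finset.single_le_sum (f := fun j => ‖x j‖ ^ 2) (fun j _ => by positivity)
      (Finset.mem_univ i)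
    have h2 : ‖x i‖ ^ 2 ≤ 1 := h ▸ this
    exact (sq_le_one_iff₀ (norm_nonneg _)).mp h2

theorem unitSphere_nonempty {n : ℕ} (hn : 1 ≤ n) :
    Nonempty {x : Fin n → ℂ // star x ⬝ᵥ x = 1} :=
  ⟨⟨Pi.single ⟨0, hn⟩ 1, by simp⟩⟩

theorem continuous_productState {n₁ n₂ : ℕ} :
    Continuous (productState : POmega n₁ n₂ → _) := by
  refine continuous_matrix fun i j => ?_
  simp only [productState, vecMulVec_apply, vKron, Pi.star_apply]
  have hx : ∀ k, Continuous fun ω : POmega n₁ n₂ => ω.1.1 k := fun k =>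
    (continuous_apply k).comp (continuous_subtype_val.comp continuous_fst)
  have hy : ∀ k, Continuous fun ω : POmega n₁ n₂ => ω.2.1 k := fun k =>
    (continuous_apply k).comp (continuous_subtype_val.comp continuous_snd)
  exact ((hx _).mul (hy _)).mul ((hx _).mul (hy _)).star

theorem continuous_bGamble {n₁ n₂ : ℕ} (G : Matrix (Fin n₁ × Fin n₂) (Fin n₁ × Fin n₂) ℂ) :
    Continuous (bGamble G) := by
  simp_rw [funext (bGamble_eq_re_trace G)]
  exact Complex.continuous_re.comp (continuous_const.matrix_mul continuous_productState).matrix_trace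

theorem isDensity_vecMulVec {n : ℕ} (x : {x : Fin n → ℂ // star x ⬝ᵥ x = 1}) :
    IsDensity (vecMulVec x.1 (star x.1)) :=
  ⟨posSemidef_vecMulVec_self_star _, by rw [trace_vecMulVec, dotProduct_comm, x.2]⟩

/-- Every density matrix is a convex combination of rank-one projections. -/
theorem IsDensity.exists_eq_sum {n : ℕ} {A : Matrix (Fin n) (Fin n) ℂ} (hA : IsDensity A) :
    ∃ (w : Fin n → ℝ) (x : Fin n → {x : Fin n → ℂ // star x ⬝ᵥ x = 1}),
      (∀ i, 0 ≤ w i) ∧ ∑ i, w i = 1 ∧ A = ∑ i, w i • vecMulVec (x i).1 (star (x i).1) := by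
  have hH := hA.1.isHermitian
  let U : Matrix (Fin n) (Fin n) ℂ := hH.eigenvectorUnitary
  have hU : star U * U = 1 := Unitary.coe_star_mul_self _
  refine ⟨hH.eigenvalues, fun k => ⟨fun i => U i k, ?_⟩, hA.1.eigenvalues_nonneg, ?_, ?_⟩
  · have := congr_fun₂ hU k k
    simpa [Matrix.mul_apply, dotProduct, star_apply] using this
  · have h := hH.trace_eq_sum_eigenvalues
    rw [hA.2] at h
    simpa using (congrArg Complex.re h).symm
  · ext i j
    have h := congr_fun₂ hH.spectral_theorem i j
    rw [Unitary.conjStarAlgAut_apply] at h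
    rw [h, Matrix.mul_apply, Matrix.sum_apply]
    refine Finset.sum_congr rfl fun k _ => ?_
    rw [Matrix.mul_diagonal]
    simp [U, vecMulVec_apply, star_apply]
    ring

theorem separable_iff_mem_convexHull {n₁ n₂ : ℕ}
    {ρ : Matrix (Fin n₁ × Fin n₂) (Fin n₁ × Fin n₂) ℂ} :
    Separable ρ ↔ ρ ∈ convexHull ℝ (Set.range (productState : POmega n₁ n₂ → _)) := by
  constructor
  · rintro ⟨k, p, A, B, hp, hp1, hA, hB, rfl⟩
    refine (convex_convexHull ℝ _).sum_mem (fun i _ => hp i) hp1 fun i _ => ?_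
    obtain ⟨w, x, hw, hw1, hAx⟩ := (hA i).exists_eq_sum
    obtain ⟨v, y, hv, hv1, hBy⟩ := (hB i).exists_eq_sum
    refine mem_convexHull_of_exists_fintype (fun q : Fin n₁ × Fin n₂ => w q.1 * v q.2)
      (fun q => productState (x q.1, y q.2)) (fun q => mul_nonneg (hw _) (hv _)) ?_
      (fun q => ⟨_, rfl⟩) ?_
    · rw [Fintype.sum_prod_type, ← Finset.sum_mul_sum, hw1, hv1, mul_one]
    · ext a b
      rw [hAx, hBy, kroneckerMap_apply, Matrix.sum_apply, Matrix.sum_apply, Matrix.sum_apply,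
        Finset.sum_mul_sum, Fintype.sum_prod_type]
      refine Finset.sum_congr rfl fun i _ => Finset.sum_congr rfl fun j _ => ?_
      simp [productState_eq_kronecker, kroneckerMap_apply]
      ring
  · intro h
    obtain ⟨ι, _, w, z, hw, hw1, hz, rfl⟩ := mem_convexHull_iff_exists_fintype.mp h
    choose ω hω using hz
    let e := (Fintype.equivFin ι).symm
    refine ⟨Fintype.card ι, w ∘ e, fun i => vecMulVec (ω (e i)).1.1 (star (ω (e i)).1.1),
      fun i => vecMulVec (ω (e i)).2.1 (star (ω (e i)).2.1), fun i => hw _, ?_,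
      fun i => isDensity_vecMulVec _, fun i => isDensity_vecMulVec _, ?_⟩
    · rw [← hw1]
      exact e.sum_comp w
    · rw [← e.sum_comp]
      simp_rw [← productState_eq_kronecker, hω]
      rfl

/-- For Hermitian matrices `G` and `M`, the trace of `G * M` is real. -/
theorem trace_mul_im_eq_zero {d : Type*} [Fintype d] {G M : Matrix d d ℂ}
    (hG : G.IsHermitian) (hM : M.IsHermitian) : (G * M).trace.im = 0 := by
  rw [← Complex.conj_eq_iff_im, ← Complex.star_def, ← trace_conjTranspose, conjTranspose_mul,
    hG.eq, hM.eq, trace_mul_comm]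

/-- A real-linear functional on complex matrices is represented on the Hermitian matrices by
pairing with a Hermitian matrix. -/
theorem exists_isHermitian_re_trace_eq {d : Type*} [Fintype d] [DecidableEq d]
    (f : Matrix d d ℂ →ₗ[ℝ] ℝ) :
    ∃ G : Matrix d d ℂ, G.IsHermitian ∧ ∀ M : Matrix d d ℂ, M.IsHermitian →
      (G * M).trace.re = f M := by
  let G₀ : Matrix d d ℂ := Matrix.of fun i j =>
    (f (Matrix.single j i 1) : ℂ) - Complex.I * f (Matrix.single j i Complex.I)
  have h₀ : ∀ M : Matrix d d ℂ, (G₀ * M).trace.re = f M := by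
    intro M
    have hs : ∀ i j (z : ℂ), f (Matrix.single i j z) =
        z.re * f (Matrix.single i j 1) + z.im * f (Matrix.single i j Complex.I) := by
      intro i j z
      rw [← smul_eq_mul, ← smul_eq_mul, ← map_smul, ← map_smul, ← map_add, smul_single, smul_single,
        ← single_add]
      congr 2
      simp [Complex.re_add_im]
    conv_rhs => rw [matrix_eq_sum_single M]
    simp only [map_sum]
    rw [Finset.sum_comm]
    simp only [trace, diag_apply, Matrix.mul_apply, Complex.re_sum]
    refine Finset.sum_congr rfl fun i _ => Finset.sum_congr rfl fun j _ => ?_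
    rw [hs j i (M j i)]
    simp [G₀]
    ring
  refine ⟨(1 / 2 : ℝ) • (G₀ + G₀ᴴ), ?_, fun M hM => ?_⟩
  · rw [IsHermitian, conjTranspose_smul, conjTranspose_add, conjTranspose_conjTranspose,
      add_comm, star_trivial]
  · have h1 : (G₀ᴴ * M).trace.re = (G₀ * M).trace.re := by
      rw [← Complex.conj_re, ← Complex.star_def, ← trace_conjTranspose, conjTranspose_mul,
        conjTranspose_conjTranspose, hM.eq, trace_mul_comm]
    rw [smul_mul, trace_smul, add_mul, trace_add, Complex.smul_re, Complex.add_re, h1, h₀,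
      smul_eq_mul]
    ring

instance locallyConvexSpace_matrix {d : Type*} : LocallyConvexSpace ℝ (Matrix d d ℂ) :=
  inferInstanceAs (LocallyConvexSpace ℝ (d → d → ℂ))

theorem isHermitian_productState {n₁ n₂ : ℕ} (ω : POmega n₁ n₂) :
    (productState ω).IsHermitian :=
  (posSemidef_vecMulVec_self_star _).isHermitian

theorem trace_productState {n₁ n₂ : ℕ} (ω : POmega n₁ n₂) : (productState ω).trace = 1 := by
  rw [productState_eq_kronecker, trace_kronecker, (isDensity_vecMulVec ω.1).2,
    (isDensity_vecMulVec ω.2).2, mul_one]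

/-- A density matrix that is not separable admits an entanglement witness. -/
theorem exists_witness_of_not_separable {n₁ n₂ : ℕ} (hn₁ : 1 ≤ n₁) (hn₂ : 1 ≤ n₂)
    {ρ : Matrix (Fin n₁ × Fin n₂) (Fin n₁ × Fin n₂) ℂ} (hρ : IsDensity ρ)
    (h : ¬Separable ρ) :
    ∃ G : Matrix (Fin n₁ × Fin n₂) (Fin n₁ × Fin n₂) ℂ,
      G.IsHermitian ∧ 0 ≤ (G * ρ).trace ∧ (⨆ ω, bGamble G ω) < 0 := by
  rw [separable_iff_mem_convexHull] at h
  have hK := isCompact_convexHull_of_finiteDimensional (isCompact_range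
    (continuous_productState (n₁ := n₁) (n₂ := n₂)))
  obtain ⟨f, u, hfK, hfρ⟩ :=
    geometric_hahn_banach_closed_point (convex_convexHull ℝ _) hK.isClosed h
  obtain ⟨G, hG, hGf⟩ := exists_isHermitian_re_trace_eq f.toLinearMap
  have hG' : (G - (f ρ) • (1 : Matrix (Fin n₁ × Fin n₂) (Fin n₁ × Fin n₂) ℂ)).IsHermitian :=
    hG.sub (by rw [IsHermitian, conjTranspose_smul, conjTranspose_one, star_trivial])
  have key : ∀ M : Matrix (Fin n₁ × Fin n₂) (Fin n₁ × Fin n₂) ℂ, M.IsHermitian → M.trace = 1 →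
      ((G - (f ρ) • (1 : Matrix (Fin n₁ × Fin n₂) (Fin n₁ × Fin n₂) ℂ)) * M).trace.re =
        f M - f ρ := by
    intro M hM hM1
    rw [sub_mul, trace_sub, Complex.sub_re, hGf M hM, smul_mul, one_mul, trace_smul, hM1]
    simp
  refine ⟨_, hG', ?_, ?_⟩
  · rw [Complex.nonneg_iff, trace_mul_im_eq_zero hG' hρ.1.isHermitian,
      key ρ hρ.1.isHermitian hρ.2]
    simp
  · have := unitSphere_nonempty hn₁
    have := unitSphere_nonempty hn₂
    refine (ciSup_le fun ω => ?_).trans_lt (sub_neg.mpr hfρ)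
    rw [bGamble_eq_re_trace, key _ (isHermitian_productState ω) (trace_productState ω)]
    exact sub_le_sub_right (hfK _ (subset_convexHull ℝ _ ⟨ω, rfl⟩)).le _

theorem bddAbove_of_mem_posi {n₁ n₂ : ℕ}
    {ρ : Matrix (Fin n₁ × Fin n₂) (Fin n₁ × Fin n₂) ℂ} {g : POmega n₁ n₂ → ℝ}
    (hg : g ∈ posi (Cof ρ ∪ Lnn n₁ n₂)) : BddAbove (Set.range g) := by
  obtain ⟨ℓ, lam, gs, hlam, hgs, rfl⟩ := hg
  have hb : ∀ i, ∃ M : ℝ, ∀ ω, gs i ω ≤ M := by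
    intro i
    rcases hgs i with ⟨G, -, -, hG⟩ | ⟨-, hM⟩
    · obtain ⟨M, hM⟩ := (isCompact_range (continuous_bGamble G)).bddAbove
      exact ⟨M, fun ω => hG ▸ hM ⟨ω, rfl⟩⟩
    · exact hM
  choose M hM using hb
  refine ⟨∑ i, lam i * M i, ?_⟩
  rintro _ ⟨ω, rfl⟩
  exact Finset.sum_le_sum fun i _ => mul_le_mul_of_nonneg_left (hM i ω) (hlam i)

/-- A separable density matrix gives nonnegative expectation to all of `posi (C ∪ 𝓛≥)`, which
therefore avoids sure loss. -/
theorem not_separable_of_iSup_neg {n₁ n₂ : ℕ}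
    {ρ : Matrix (Fin n₁ × Fin n₂) (Fin n₁ × Fin n₂) ℂ} {g : POmega n₁ n₂ → ℝ}
    (hg : g ∈ posi (Cof ρ ∪ Lnn n₁ n₂)) (hneg : (⨆ ω, g ω) < 0) : ¬Separable ρ := by
  intro hsep
  have hlt : ∀ ω, g ω < 0 := fun ω => (le_ciSup (bddAbove_of_mem_posi hg) ω).trans_lt hneg
  obtain ⟨ι, _, w, z, hw, hw1, hz, hsum⟩ :=
    mem_convexHull_iff_exists_fintype.mp (separable_iff_mem_convexHull.mp hsep)
  choose ω hω using hz
  obtain ⟨ℓ, lam, gs, hlam, hgs, rfl⟩ := hg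
  have hnn : ∀ i, 0 ≤ ∑ j, w j * gs i (ω j) := by
    intro i
    rcases hgs i with ⟨G, -, hG, hGg⟩ | ⟨h0, -⟩
    · have : ∑ j, w j * gs i (ω j) = (G * ρ).trace.re := by
        rw [← hsum, Matrix.mul_sum, trace_sum, Complex.re_sum]
        refine Finset.sum_congr rfl fun j _ => ?_
        rw [hGg, bGamble_eq_re_trace, hω, Matrix.mul_smul, trace_smul, Complex.smul_re, smul_eq_mul]
      rw [this]
      exact (Complex.nonneg_iff.mp hG).1
    · exact Finset.sum_nonneg fun j _ => mul_nonneg (hw j) (h0 _)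
  have h1 : 0 ≤ ∑ j, w j * ∑ i, lam i * gs i (ω j) := by
    have : ∑ j, w j * ∑ i, lam i * gs i (ω j) = ∑ i, lam i * ∑ j, w j * gs i (ω j) := by
      simp_rw [Finset.mul_sum]
      rw [Finset.sum_comm]
      exact Finset.sum_congr rfl fun i _ => Finset.sum_congr rfl fun j _ => mul_left_comm _ _ _
    rw [this]
    exact Finset.sum_nonneg fun i _ => mul_nonneg (hlam i) (hnn i)
  obtain ⟨j, -, hj⟩ : ∃ j ∈ Finset.univ, 0 < w j :=
    Finset.exists_lt_of_sum_lt (by simp [hw1])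
  exact h1.not_gt (Finset.sum_neg' (fun k _ => mul_nonpos_of_nonneg_of_nonpos (hw k) (hlt _).le)
    ⟨j, Finset.mem_univ j, mul_neg_of_pos_of_neg hj (hlt _)⟩)

theorem bGamble_mem_posi {n₁ n₂ : ℕ} {ρ G : Matrix (Fin n₁ × Fin n₂) (Fin n₁ × Fin n₂) ℂ}
    (hG : G.IsHermitian) (hGρ : 0 ≤ (G * ρ).trace) : bGamble G ∈ posi (Cof ρ ∪ Lnn n₁ n₂) :=
  ⟨1, fun _ => 1, fun _ => bGamble G, fun _ => zero_le_one,
    fun _ => Or.inl ⟨G, hG, hGρ, rfl⟩, by simp⟩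

/-- `ρ̃` is entangled iff `posi (C ∪ 𝓛≥)` contains a gamble with
strictly negative supremum; equivalently, iff there is a Hermitian `G` with
`Tr(Gρ̃) ≥ 0` whose gamble has strictly negative supremum over the unit spheres. -/
theorem stmt15 {n₁ n₂ : ℕ} (hn₁ : 1 ≤ n₁) (hn₂ : 1 ≤ n₂)
    (ρ : Matrix (Fin n₁ × Fin n₂) (Fin n₁ × Fin n₂) ℂ) (hρ : IsDensity ρ) :
    (¬Separable ρ ↔ ∃ g ∈ posi (Cof ρ ∪ Lnn n₁ n₂), (⨆ ω, g ω) < 0)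
    ∧ (¬Separable ρ ↔ ∃ G : Matrix (Fin n₁ × Fin n₂) (Fin n₁ × Fin n₂) ℂ,
        G.IsHermitian ∧ 0 ≤ (G * ρ).trace ∧ (⨆ ω, bGamble G ω) < 0) := by
  refine ⟨⟨fun h => ?_, fun ⟨g, hg, hneg⟩ => not_separable_of_iSup_neg hg hneg⟩,
    exists_witness_of_not_separable hn₁ hn₂ hρ,
    fun ⟨G, hG, hGρ, hneg⟩ => not_separable_of_iSup_neg (bGamble_mem_posi hG hGρ) hneg⟩
  obtain ⟨G, hG, hGρ, hneg⟩ := exists_witness_of_not_separable hn₁ hn₂ hρ h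
  exact ⟨bGamble G, bGamble_mem_posi hG hGρ, hneg⟩
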